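/- arXiv:math-ph/0505053 — 3 statements merged into one kernel-verified Lean document; each statement's English description precedes it below -/
import Mathlib

section
/- The liminf as k tends to infinity of S_k, the sum of the inverse squares of the denominators of the new (even-order) fractions at level k, equals 0. -/
/-- Numerators of the modified Farey sequence: at level `k`, order `n` (1-indexed,
`n = 1, …, 2^k + 1`). Level 0 is `0/1, 1/1`; odd orders at level `k+1` are carried
over from level `k`, even orders are mediants. -/
def fareyNum : ℕ → ℕ → ℕ
  | 0, n => if n = 1 then 0 else 1
  | k + 1, m =>
      if m % 2 = 1 then fareyNum k ((m + 1) / 2)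
      else fareyNum k (m / 2) + fareyNum k (m / 2 + 1)

/-- Denominators of the modified Farey sequence. -/
def fareyDen : ℕ → ℕ → ℕ
  | 0, _ => 1
  | k + 1, m =>
      if m % 2 = 1 then fareyDen k ((m + 1) / 2)
      else fareyDen k (m / 2) + fareyDen k (m / 2 + 1)

/-- The Farey fraction `r_k^(n) = n_k^(n) / d_k^(n)` as a real number. -/
noncomputable def fareyR (k n : ℕ) : ℝ := (fareyNum k n : ℝ) / (fareyDen k n : ℝ)

/-- The interval `I_k^(n)`: for `n ≥ 2` it is `r_k^(2n) - r_k^(2n-2)`, and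
`I_k^(1) := 2/(k+1)`. -/
noncomputable def fareyI (k n : ℕ) : ℝ :=
  if n = 1 then 2 / ((k : ℝ) + 1) else fareyR k (2 * n) - fareyR k (2 * n - 2)

/-- Total length of even intervals at level `k`. -/
noncomputable def fareyIe (k : ℕ) : ℝ :=
  ∑ i ∈ Finset.Icc 1 (2 ^ (k - 2)), fareyI k (2 * i)

/-- Total length of odd intervals at level `k`. -/
noncomputable def fareyIo (k : ℕ) : ℝ :=
  ∑ i ∈ Finset.Icc 1 (2 ^ (k - 2)), fareyI k (2 * i - 1)

/-- `S_k`: the sum of inverse squares of the new denominators at level `k`. -/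
noncomputable def fareyS (k : ℕ) : ℝ :=
  ∑ n ∈ Finset.Icc 1 (2 ^ (k - 1)), 1 / (fareyDen k (2 * n) : ℝ) ^ 2

theorem fareyDen_succ_two_mul (k n : ℕ) :
    fareyDen (k + 1) (2 * n) = fareyDen k n + fareyDen k (n + 1) := by
  simp [fareyDen]

theorem fareyDen_succ_two_mul_add_one (k n : ℕ) :
    fareyDen (k + 1) (2 * n + 1) = fareyDen k (n + 1) := by
  have h : (2 * n + 1) % 2 = 1 := by omega
  have h' : (2 * n + 1 + 1) / 2 = n + 1 := by omega
  simp [fareyDen, h, h']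

theorem fareyDen_pos (k n : ℕ) : 0 < fareyDen k n := by
  induction k generalizing n with
  | zero => simp [fareyDen]
  | succ k ih =>
    rw [fareyDen]
    split_ifs
    · exact ih _
    · exact Nat.add_pos_left (ih _) _

theorem sum_range_two_mul {M : Type*} [AddCommMonoid M] (f : ℕ → M) (N : ℕ) :
    ∑ t ∈ Finset.range (2 * N), f t =
      ∑ t ∈ Finset.range N, f (2 * t) + ∑ t ∈ Finset.range N, f (2 * t + 1) := by
  induction N with
  | zero => simp
  | succ N ih =>
    rw [Nat.mul_succ, Finset.sum_range_succ, Finset.sum_range_succ, ih,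
      Finset.sum_range_succ, Finset.sum_range_succ]
    abel

theorem fareyS_succ (k : ℕ) :
    fareyS (k + 1) = ∑ t ∈ Finset.range (2 ^ k),
      1 / ((fareyDen k (t + 1) : ℝ) + fareyDen k (t + 2)) ^ 2 := by
  rw [fareyS, Nat.add_sub_cancel, ← Finset.Ico_add_one_right_eq_Icc,
    Finset.sum_Ico_eq_sum_range, Nat.add_sub_cancel]
  refine Finset.sum_congr rfl fun t _ => ?_
  rw [fareyDen_succ_two_mul, add_comm 1 t]
  push_cast
  rfl

theorem fareyS_nonneg (k : ℕ) : 0 ≤ fareyS k :=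
  Finset.sum_nonneg fun _ _ => by positivity

/-- The total length of the intervals of level `j + i` whose left endpoint already occurs
at level `j`, the right endpoint `1` excluded. -/
noncomputable def fareyTail (j i : ℕ) : ℝ :=
  ∑ t ∈ Finset.range (2 ^ j),
    1 / ((fareyDen j (t + 1) : ℝ) * (i * fareyDen j (t + 1) + fareyDen j (t + 2)))

theorem fareyTail_succ (j i : ℕ) :
    fareyTail (j + 1) i = fareyTail j (i + 1) + ∑ t ∈ Finset.range (2 ^ j),
      1 / (((fareyDen j (t + 1) : ℝ) + fareyDen j (t + 2)) *
        (i * ((fareyDen j (t + 1) : ℝ) + fareyDen j (t + 2)) + fareyDen j (t + 2))) := by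
  rw [fareyTail, pow_succ', sum_range_two_mul, fareyTail]
  congr 1 <;> refine Finset.sum_congr rfl fun t _ => ?_
  · rw [fareyDen_succ_two_mul_add_one, show 2 * t + 2 = 2 * (t + 1) by ring,
      fareyDen_succ_two_mul]
    push_cast
    ring_nf
  · rw [show 2 * t + 1 + 1 = 2 * (t + 1) by ring, fareyDen_succ_two_mul,
      show 2 * t + 1 + 2 = 2 * (t + 1) + 1 by ring, fareyDen_succ_two_mul_add_one]
    push_cast
    rfl

theorem fareyTail_zero_right (k : ℕ) : fareyTail k 0 = 1 := by
  induction k with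
  | zero => simp [fareyTail, fareyDen]
  | succ k ih =>
    refine Eq.trans ?_ ih
    rw [fareyTail_succ, fareyTail, fareyTail, ← Finset.sum_add_distrib]
    refine Finset.sum_congr rfl fun t _ => ?_
    have ha : (0 : ℝ) < fareyDen k (t + 1) := by exact_mod_cast fareyDen_pos _ _
    have hb : (0 : ℝ) < fareyDen k (t + 2) := by exact_mod_cast fareyDen_pos _ _
    push_cast
    field_simp
    ring

theorem fareyTail_add_fareyS_le (j i : ℕ) :
    fareyTail j (i + 1) + fareyS (j + 1) / (i + 1) ≤ fareyTail (j + 1) i := by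
  rw [fareyTail_succ, fareyS_succ, Finset.sum_div]
  refine add_le_add le_rfl (Finset.sum_le_sum fun t _ => ?_)
  have ha : (0 : ℝ) < fareyDen j (t + 1) := by exact_mod_cast fareyDen_pos _ _
  have hb : (0 : ℝ) < fareyDen j (t + 2) := by exact_mod_cast fareyDen_pos _ _
  rw [div_div]
  apply one_div_le_one_div_of_le
  · positivity
  · nlinarith [mul_pos ha ha, mul_pos ha hb]

theorem sum_fareyS_div_le_fareyTail (j i : ℕ) :
    ∑ l ∈ Finset.range j, fareyS (l + 1) / ((j : ℝ) - l + i) ≤ fareyTail j i := by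
  induction j generalizing i with
  | zero => exact Finset.sum_nonneg fun _ _ => by positivity
  | succ j ih =>
    refine le_trans ?_ (fareyTail_add_fareyS_le j i)
    rw [Finset.sum_range_succ]
    refine add_le_add (le_trans (le_of_eq ?_) (ih (i + 1))) (le_of_eq ?_)
    · refine Finset.sum_congr rfl fun l _ => ?_
      push_cast
      ring_nf
    · push_cast
      ring_nf

theorem sum_fareyS_div_le_one (k : ℕ) :
    ∑ l ∈ Finset.range k, fareyS (l + 1) / ((k : ℝ) - l) ≤ 1 := by
  simpa [fareyTail_zero_right] using sum_fareyS_div_le_fareyTail k 0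

theorem frequently_fareyS_le {ε : ℝ} (hε : 0 < ε) :
    ∃ᶠ k in Filter.atTop, fareyS k ≤ ε := by
  intro h
  obtain ⟨J, hJ⟩ := Filter.eventually_atTop.1 h
  obtain ⟨N, hN⟩ := (Real.tendsto_sum_range_one_div_nat_succ_atTop.eventually_gt_atTop
    (1 / ε)).exists
  refine (sum_fareyS_div_le_one (J + N)).not_gt ?_
  rw [Finset.sum_range_add]
  have hhead : 0 ≤ ∑ l ∈ Finset.range J, fareyS (l + 1) / (((J + N : ℕ) : ℝ) - l) := by
    refine Finset.sum_nonneg fun l hl => div_nonneg (fareyS_nonneg _) (sub_nonneg.2 ?_)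
    exact_mod_cast (Finset.mem_range.1 hl).le.trans (Nat.le_add_right J N)
  have htail : ε * ∑ m ∈ Finset.range N, 1 / ((m : ℝ) + 1) ≤
      ∑ l ∈ Finset.range N, fareyS (J + l + 1) / (((J + N : ℕ) : ℝ) - (J + l : ℕ)) := by
    rw [← Finset.sum_range_reflect, Finset.mul_sum]
    refine Finset.sum_le_sum fun l hl => ?_
    have hl' : l + 1 ≤ N := Finset.mem_range.1 hl
    have hden : ((J + N : ℕ) : ℝ) - (J + l : ℕ) = ((N - 1 - l : ℕ) : ℝ) + 1 := by
      rw [Nat.sub_sub, add_comm 1 l, Nat.cast_sub hl']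
      push_cast
      ring
    rw [hden, mul_one_div]
    have := (not_le.1 (hJ (J + l + 1) (by omega))).le
    gcongr
  have := (div_lt_iff₀' hε).1 hN
  linarith

/-- The liminf as `k → ∞` of `S_k` equals 0. -/
theorem liminf_fareyS_eq_zero :
    Filter.liminf (fun k : ℕ => fareyS k) Filter.atTop = 0 := by
  have hbdd : Filter.IsBoundedUnder (· ≥ ·) Filter.atTop fareyS :=
    Filter.isBoundedUnder_of ⟨0, fareyS_nonneg⟩
  apply le_antisymm
  · refine le_of_forall_gt_imp_ge_of_dense fun ε hε => ?_
    exact Filter.liminf_le_of_frequently_le (frequently_fareyS_le hε) hbdd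
  · exact Filter.le_liminf_of_le
      (Filter.IsCoboundedUnder.of_frequently_le (frequently_fareyS_le one_pos))
      (Filter.Eventually.of_forall fareyS_nonneg)
end

section
/- For every k >= 0, every l >= 1, and every 1 <= n <= 2^k, the descendant interval at level k+l+1 satisfies I_{k+l+1}^(2^{l-1}(2n-1)+1) = (2l+1) / ((l*d_k^(n) + (l+1)*d_k^(n+1)) * ((l+1)*d_k^(n) + l*d_k^(n+1))). -/
/-- The recursion shared by the numerators and the denominators of the modified Farey sequence:
odd orders are carried over, even orders are sums of neighbours. -/
structure IsMediantSequence (f : ℕ → ℕ → ℕ) : Prop where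
  odd (k m : ℕ) : f (k + 1) (2 * m + 1) = f k (m + 1)
  even (k m : ℕ) : f (k + 1) (2 * m) = f k m + f k (m + 1)

theorem isMediantSequence_fareyNum : IsMediantSequence fareyNum where
  odd k m := by
    rw [fareyNum, if_pos (by omega), show (2 * m + 1 + 1) / 2 = m + 1 by omega]
  even k m := by
    rw [fareyNum, if_neg (by omega), show 2 * m / 2 = m by omega]

theorem isMediantSequence_fareyDen : IsMediantSequence fareyDen where
  odd k m := by
    rw [fareyDen, if_pos (by omega), show (2 * m + 1 + 1) / 2 = m + 1 by omega]
  even k m := by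
    rw [fareyDen, if_neg (by omega), show 2 * m / 2 = m by omega]

namespace IsMediantSequence

variable {f : ℕ → ℕ → ℕ}

theorem carry (hf : IsMediantSequence f) (k l j : ℕ) :
    f (k + l) (2 ^ l * j + 1) = f k (j + 1) := by
  induction l with
  | zero => simp
  | succ l ih =>
    rw [← add_assoc, show 2 ^ (l + 1) * j + 1 = 2 * (2 ^ l * j) + 1 by ring, hf.odd, ih]

/-- The right neighbour, `l` levels later, of an element of level `k`. -/
theorem right_neighbour (hf : IsMediantSequence f) (k l j : ℕ) :
    f (k + l) (2 ^ l * j + 2) = f k (j + 2) + l * f k (j + 1) := by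
  induction l with
  | zero => simp
  | succ l ih =>
    rw [← add_assoc, show 2 ^ (l + 1) * j + 2 = 2 * (2 ^ l * j + 1) by ring, hf.even, hf.carry, ih]
    ring

/-- The left neighbour, `l` levels later, of an element of level `k`. -/
theorem left_neighbour (hf : IsMediantSequence f) (k l j : ℕ) :
    f (k + l) (2 ^ l * j) = f k j + l * f k (j + 1) := by
  induction l with
  | zero => simp
  | succ l ih =>
    rw [← add_assoc, show 2 ^ (l + 1) * j = 2 * (2 ^ l * j) by ring, hf.even, hf.carry, ih]
    ring

end IsMediantSequence

/-- Consecutive modified Farey fractions are unimodular. -/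
theorem fareyNum_succ_mul_fareyDen {k n : ℕ} (h1 : 1 ≤ n) (h2 : n ≤ 2 ^ k) :
    fareyNum k (n + 1) * fareyDen k n = fareyNum k n * fareyDen k (n + 1) + 1 := by
  induction k generalizing n with
  | zero =>
    obtain rfl : n = 1 := by simp at h2; omega
    simp [fareyNum, fareyDen]
  | succ k ih =>
    have hN := isMediantSequence_fareyNum
    have hD := isMediantSequence_fareyDen
    rw [pow_succ] at h2
    obtain ⟨m, rfl | rfl⟩ := Nat.even_or_odd' n
    · have := ih (n := m) (by omega) (by omega)
      rw [hN.even, hN.odd, hD.even, hD.odd]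
      linear_combination this
    · have := ih (n := m + 1) (by omega) (by omega)
      rw [show 2 * m + 1 + 1 = 2 * (m + 1) by ring, hN.even, hN.odd, hD.even, hD.odd]
      linear_combination this

/-- Length of the `l`-th descendant interval at level `k + l + 1` in terms of
denominators at level `k`. -/
theorem farey_descendant_interval_length (k l n : ℕ) (hl : 1 ≤ l)
    (h1 : 1 ≤ n) (h2 : n ≤ 2 ^ k) :
    fareyI (k + l + 1) (2 ^ (l - 1) * (2 * n - 1) + 1) =
      (2 * (l : ℝ) + 1) /
        (((l : ℝ) * (fareyDen k n : ℝ) + ((l : ℝ) + 1) * (fareyDen k (n + 1) : ℝ)) *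
          (((l : ℝ) + 1) * (fareyDen k n : ℝ) + (l : ℝ) * (fareyDen k (n + 1) : ℝ))) := by
  obtain ⟨p, rfl⟩ := Nat.exists_eq_add_of_le' hl
  have hN := isMediantSequence_fareyNum
  have hD := isMediantSequence_fareyDen
  have hdet : (fareyNum k (n + 1) : ℝ) * fareyDen k n = fareyNum k n * fareyDen k (n + 1) + 1 := by
    exact_mod_cast fareyNum_succ_mul_fareyDen h1 h2
  have hd : (0 : ℝ) < fareyDen k n := by exact_mod_cast fareyDen_pos k n
  have hd' : (0 : ℝ) < fareyDen k (n + 1) := by exact_mod_cast fareyDen_pos k (n + 1)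
  have hne : 2 ^ (p + 1 - 1) * (2 * n - 1) + 1 ≠ 1 := by
    have : 0 < 2 ^ (p + 1 - 1) * (2 * n - 1) := Nat.mul_pos (by positivity) (by omega)
    omega
  have hright : 2 * (2 ^ (p + 1 - 1) * (2 * n - 1) + 1) = 2 ^ (p + 1) * (2 * n - 1) + 2 := by
    rw [Nat.add_sub_cancel]; ring
  have hR {f : ℕ → ℕ → ℕ} (hf : IsMediantSequence f) :
      f (k + (p + 1) + 1) (2 ^ (p + 1) * (2 * n - 1) + 2) =
        f k (n + 1) + (p + 1) * (f k n + f k (n + 1)) := by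
    rw [add_right_comm, hf.right_neighbour, show 2 * n - 1 + 2 = 2 * n + 1 by omega,
      Nat.sub_add_cancel (by omega), hf.odd, hf.even]
  have hL {f : ℕ → ℕ → ℕ} (hf : IsMediantSequence f) :
      f (k + (p + 1) + 1) (2 ^ (p + 1) * (2 * n - 1)) =
        f k n + (p + 1) * (f k n + f k (n + 1)) := by
    rw [add_right_comm, hf.left_neighbour, Nat.sub_add_cancel (by omega), hf.even,
      show 2 * n - 1 = 2 * (n - 1) + 1 by omega, hf.odd, Nat.sub_add_cancel h1]
  rw [fareyI, if_neg hne, hright, Nat.add_sub_cancel, fareyR, fareyR, hR hN, hR hD, hL hN, hL hD]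
  push_cast
  rw [div_sub_div _ _ (by positivity) (by positivity), div_eq_div_iff (by positivity)
    (by positivity)]
  generalize (fareyNum k (n + 1) : ℝ) = a' at *
  generalize (fareyNum k n : ℝ) = a at *
  generalize (fareyDen k (n + 1) : ℝ) = d' at *
  generalize (fareyDen k n : ℝ) = d at *
  linear_combination (2 * (p : ℝ) + 3) * ((((p : ℝ) + 1) * d + ((p : ℝ) + 1 + 1) * d') *
    (((p : ℝ) + 1 + 1) * d + ((p : ℝ) + 1) * d')) * hdet
end

section
/- For every real z > 0 and every integer j >= 1, the function f(z) = ((2j+3)/3) * (1+2z)(2+z) / (((j+1) + (j+2)z) * ((j+2) + (j+1)z)) satisfies 2(2j+3)/(3(j+1)(j+2)) <= f(z) <= 3/(2j+3); the lower bound is the value at z = 0 and the upper bound is the value at z = 1. -/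
/-- For every real `z > 0` and integer `j ≥ 1`, the function
`f(z) = ((2j+3)/3) (1+2z)(2+z) / (((j+1)+(j+2)z)((j+2)+(j+1)z))` satisfies
`2(2j+3)/(3(j+1)(j+2)) ≤ f(z) ≤ 3/(2j+3)`; the lower bound is the value at
`z = 0` and the upper bound is the value at `z = 1`. -/
theorem ratio_function_bounds (j : ℕ) (hj : 1 ≤ j) (f : ℝ → ℝ)
    (hf : ∀ z : ℝ, f z =
      ((2 * (j : ℝ) + 3) / 3) * ((1 + 2 * z) * (2 + z)) /
        ((((j : ℝ) + 1) + ((j : ℝ) + 2) * z) * (((j : ℝ) + 2) + ((j : ℝ) + 1) * z))) :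
    (∀ z : ℝ, 0 < z →
      2 * (2 * (j : ℝ) + 3) / (3 * ((j : ℝ) + 1) * ((j : ℝ) + 2)) ≤ f z ∧
        f z ≤ 3 / (2 * (j : ℝ) + 3)) ∧
    f 0 = 2 * (2 * (j : ℝ) + 3) / (3 * ((j : ℝ) + 1) * ((j : ℝ) + 2)) ∧
    f 1 = 3 / (2 * (j : ℝ) + 3) := by
  have hj' : (1 : ℝ) ≤ j := by exact_mod_cast hj
  refine ⟨fun z hz => ?_, ?_, ?_⟩
  · have hP : 0 ≤ ((j : ℝ) + 1) * (j + 2) - 2 := by nlinarith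
    rw [hf]
    constructor
    · rw [div_le_div_iff₀ (by positivity) (by positivity)]
      have h : 0 ≤ (2 * (j : ℝ) + 3) * ((((j : ℝ) + 1) * (j + 2) - 2) * z) := by positivity
      linear_combination h
    · rw [div_le_div_iff₀ (by positivity) (by positivity)]
      have h : 0 ≤ (((j : ℝ) + 1) * (j + 2) - 2) * (1 - z) ^ 2 := by positivity
      linear_combination h / 3
  · rw [hf]
    field_simp
    ring
  · rw [hf]
    have h : (j : ℝ) + 1 + (j + 2) * 1 = 2 * j + 3 := by ring
    have h' : (j : ℝ) + 2 + (j + 1) * 1 = 2 * j + 3 := by ring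
    rw [h, h']
    field_simp
    norm_num
end
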